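/- Let m ≥ 2, 2 ≤ ℓ ≤ m, and let (f_1, …, f_ℓ) be a (2m, ℓ) bent vectorial function on GF(2^{2m}). Fix a codeword u of C(f_1, …, f_ℓ) of Hamming weight 2^{2m−1} − 2^{m−1}. Then among the codewords v ≠ u of weight 2^{2m−1} − 2^{m−1}, exactly 2^m(2^m + 1)(2^{ℓ−1} − 1) satisfy |supp(u) ∩ supp(v)| = 2^{2m−2} − 2^{m−2}, exactly 2^{2m} − 1 satisfy |supp(u) ∩ supp(v)| = 2^{2m−2} − 2^{m−1}, and exactly 2^m(2^m − 1)(2^{ℓ−1} − 1) satisfy |supp(u) ∩ supp(v)| = 2^{2m−2} − 3·2^{m−2}. -/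

import Mathlib

noncomputable section

/-- The finite field `GF(2^n)` is finite. -/
instance (n : ℕ) : Fintype (GaloisField 2 n) := Fintype.ofFinite _

/-- The absolute trace map from `GF(2^(2m))` to `GF(2)`. -/
def tr (m : ℕ) (x : GaloisField 2 (2*m)) : ZMod 2 :=
  Algebra.trace (ZMod 2) (GaloisField 2 (2*m)) x

/-- A Boolean function `f : GF(2^(2m)) → GF(2)` is bent if all its Walsh
transform values have absolute value `2^m`. -/
def IsBent (m : ℕ) (f : GaloisField 2 (2*m) → ZMod 2) : Prop :=
  ∀ w : GaloisField 2 (2*m),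
    |∑ x : GaloisField 2 (2*m), (-1 : ℤ) ^ ((f x + tr m (w * x)).val)| = 2 ^ m

/-- A tuple `(f 0, …, f (ℓ-1))` of Boolean functions on `GF(2^(2m))` is a
`(2m, ℓ)` bent vectorial function if every nonzero `GF(2)`-linear combination
of the `f j` is bent. -/
def IsBentVectorial (m ℓ : ℕ) (f : Fin ℓ → GaloisField 2 (2*m) → ZMod 2) : Prop :=
  ∀ a : Fin ℓ → ZMod 2, a ≠ 0 → IsBent m (fun x => ∑ j, a j * f j x)

/-- The binary linear code `C(f 0, …, f (ℓ-1))` of length `2^(2m)` (with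
coordinates indexed by `GF(2^(2m))`, a codeword being a function
`GF(2^(2m)) → GF(2)`, i.e. the truth table of a Boolean function), spanned by
the truth tables of the `f j`, the truth tables of the linear functions
`x ↦ tr (w * x)` for all `w`, and the all-one vector. -/
def code (m ℓ : ℕ) (f : Fin ℓ → GaloisField 2 (2*m) → ZMod 2) :
    Submodule (ZMod 2) (GaloisField 2 (2*m) → ZMod 2) :=
  Submodule.span (ZMod 2)
    (Set.range f ∪ Set.range (fun w => fun x => tr m (w * x)) ∪ {fun _ => (1 : ZMod 2)})

/-- The Hamming weight of a codeword: the number of nonzero coordinates. -/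
def wt (m : ℕ) (c : GaloisField 2 (2*m) → ZMod 2) : ℕ :=
  {x | c x ≠ 0}.ncard

/-- The support of a codeword: the set of coordinates where it is nonzero. -/
def supp (m : ℕ) (c : GaloisField 2 (2*m) → ZMod 2) : Set (GaloisField 2 (2*m)) :=
  {x | c x ≠ 0}

def chi (z : ZMod 2) : ℤ := (-1 : ℤ) ^ z.val

lemma chi_add (a b : ZMod 2) : chi (a + b) = chi a * chi b := by
  revert a b; decide

lemma chi_cases (a : ZMod 2) : a = 0 ∨ a = 1 := by
  revert a; decide

lemma chi_zero : chi 0 = 1 := by decide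
lemma chi_one : chi 1 = -1 := by decide
lemma chi_sq (a : ZMod 2) : chi a * chi a = 1 := by
  revert a; decide

def SS (m : ℕ) (g : GaloisField 2 (2*m) → ZMod 2) : ℤ := ∑ x, chi (g x)

lemma cardF (m : ℕ) (hm : 2 ≤ m) : Fintype.card (GaloisField 2 (2*m)) = 2^(2*m) := by
  rw [← Nat.card_eq_fintype_card]
  exact GaloisField.card 2 (2*m) (by omega)

lemma tr_add (m : ℕ) (x y : GaloisField 2 (2*m)) : tr m (x + y) = tr m x + tr m y := by
  simp [tr]

lemma tr_zero (m : ℕ) : tr m 0 = 0 := by simp [tr]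

lemma exists_tr (m : ℕ) (z : GaloisField 2 (2*m)) (hz : z ≠ 0) :
    ∃ w, tr m (w * z) = 1 := by
  by_contra! hcon
  apply hz
  have : Algebra.IsAlgebraic (ZMod 2) (GaloisField 2 (2*m)) := Algebra.IsAlgebraic.of_finite _ _
  have : Algebra.IsSeparable (ZMod 2) (GaloisField 2 (2*m)) :=
    Algebra.IsAlgebraic.isSeparable_of_perfectField
  refine (traceForm_nondegenerate (ZMod 2) (GaloisField 2 (2*m))).1 z fun w => ?_
  rw [Algebra.traceForm_apply, mul_comm z w]
  exact (chi_cases (tr m (w * z))).resolve_right (hcon w)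

lemma sum_tr (m : ℕ) (z : GaloisField 2 (2*m)) (hz : z ≠ 0) :
    ∑ w, chi (tr m (w * z)) = 0 := by
  obtain ⟨w1, h1⟩ := exists_tr m z hz
  have h : ∑ w, chi (tr m (w * z)) = ∑ w, chi (tr m ((w + w1) * z)) :=
    (Equiv.sum_comp (Equiv.addRight w1) (fun w => chi (tr m (w * z)))).symm
  simp only [add_mul, tr_add, chi_add, h1, chi_one] at h
  rw [← Finset.sum_mul] at h
  linarith

lemma S_tr (m : ℕ) (w : GaloisField 2 (2*m)) (hw : w ≠ 0) :
    SS m (fun x => tr m (w * x)) = 0 := by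
  simp only [SS, mul_comm w]
  exact sum_tr m w hw

lemma ncard_eq_sum (m : ℕ) (p : GaloisField 2 (2*m) → Prop) [DecidablePred p] :
    (({x | p x}.ncard : ℕ) : ℤ) = ∑ x, if p x then 1 else 0 := by
  rw [Finset.sum_boole, Set.ncard_eq_toFinset_card']
  simp

lemma S_wt (m : ℕ) (hm : 2 ≤ m) (g : GaloisField 2 (2*m) → ZMod 2) :
    SS m g = 2^(2*m) - 2 * (wt m g : ℤ) := by
  rw [wt, ncard_eq_sum]
  have : ((2:ℤ)^(2*m)) = ∑ x : GaloisField 2 (2*m), 1 := by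
    simp [cardF m hm]
  rw [this, Finset.mul_sum, ← Finset.sum_sub_distrib, SS]
  refine Finset.sum_congr rfl fun x _ => ?_
  generalize g x = a
  revert a; decide

lemma S_inter (m : ℕ) (hm : 2 ≤ m) (g h : GaloisField 2 (2*m) → ZMod 2) :
    4 * ((supp m g ∩ supp m h).ncard : ℤ) = 2^(2*m) - SS m g - SS m h + SS m (g + h) := by
  have e : supp m g ∩ supp m h = {x | g x ≠ 0 ∧ h x ≠ 0} := rfl
  rw [e, ncard_eq_sum]
  have : ((2:ℤ)^(2*m)) = ∑ x : GaloisField 2 (2*m), 1 := by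
    simp [cardF m hm]
  simp only [SS]
  rw [this, Finset.mul_sum, ← Finset.sum_sub_distrib, ← Finset.sum_sub_distrib,
    ← Finset.sum_add_distrib]
  refine Finset.sum_congr rfl fun x _ => ?_
  simp only [Pi.add_apply]
  generalize g x = a
  generalize h x = b
  revert a b; decide

lemma wt_iff (m : ℕ) (hm : 2 ≤ m) (g : GaloisField 2 (2*m) → ZMod 2) :
    wt m g = 2^(2*m-1) - 2^(m-1) ↔ SS m g = 2^m := by
  have h := S_wt m hm g
  obtain ⟨k, rfl⟩ := Nat.exists_eq_add_of_le' hm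
  have e1 : 2 * (k+2) - 1 = 2*k+3 := by omega
  have e2 : k + 2 - 1 = k + 1 := by omega
  have e3 : 2 * (k+2) = 2*k+4 := by omega
  have h1 : (2:ℤ)^(2*(k+2)) = 2 * (2:ℤ)^(2*k+3) := by rw [e3]; ring
  have h2 : (2:ℤ)^(k+2) = 2 * (2:ℤ)^(k+1) := by ring
  have h3 : 2^(k+1) ≤ 2^(2*k+3) := Nat.pow_le_pow_right (by norm_num) (by omega)
  rw [h1] at h
  rw [e1, e2, h, h2]
  zify [h3]
  constructor <;> intro h <;> linarith

lemma inter_iff (m : ℕ) (hm : 2 ≤ m) (g h : GaloisField 2 (2*m) → ZMod 2)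
    (hg : SS m g = 2^m) (hh : SS m h = 2^m) :
    ((supp m g ∩ supp m h).ncard = 2^(2*m-2) - 2^(m-2) ↔ SS m (g + h) = 2^m) ∧
    ((supp m g ∩ supp m h).ncard = 2^(2*m-2) - 2^(m-1) ↔ SS m (g + h) = 0) ∧
    ((supp m g ∩ supp m h).ncard = 2^(2*m-2) - 3 * 2^(m-2) ↔ SS m (g + h) = - 2^m) := by
  have H := S_inter m hm g h
  rw [hg, hh] at H
  obtain ⟨k, rfl⟩ := Nat.exists_eq_add_of_le' hm
  have e1 : 2 * (k+2) - 2 = 2*k+2 := by omega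
  have e2 : k + 2 - 1 = k + 1 := by omega
  have e4 : k + 2 - 2 = k := by omega
  have e3 : 2 * (k+2) = 2*k+4 := by omega
  have h1 : (2:ℤ)^(2*(k+2)) = 4 * (2:ℤ)^(2*k+2) := by rw [e3]; ring
  have h2 : (2:ℤ)^(k+2) = 4 * (2:ℤ)^k := by ring
  have h2' : 2^(k+1) = 2 * 2^k := by ring
  have h3 : 4 * 2^k ≤ 2^(2*k+2) := by
    have : 2^(k+2) ≤ 2^(2*k+2) := Nat.pow_le_pow_right (by norm_num) (by omega)
    calc 4 * 2^k = 2^(k+2) := by ring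
      _ ≤ _ := this
  have h4 : 2^k ≤ 2^(2*k+2) := by omega
  have h5 : 2*2^k ≤ 2^(2*k+2) := by omega
  have h6 : 3*2^k ≤ 2^(2*k+2) := by omega
  rw [h1, h2] at H
  rw [e1, e2, e4, h2, h2']
  zify [h4, h5, h6]
  refine ⟨?_, ?_, ?_⟩ <;> constructor <;> intro h <;> linarith

section
variable (m ℓ : ℕ) (f : Fin ℓ → GaloisField 2 (2*m) → ZMod 2)

def Phi (b : Fin ℓ → ZMod 2) (w : GaloisField 2 (2*m)) (c : ZMod 2) :
    GaloisField 2 (2*m) → ZMod 2 := fun x => ∑ j, b j * f j x + tr m (w * x) + c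

lemma Phi_add (b b' w w' c c') : Phi m ℓ f b w c + Phi m ℓ f b' w' c' =
    Phi m ℓ f (b + b') (w + w') (c + c') := by
  funext x
  simp only [Phi, Pi.add_apply, add_mul, tr_add, Finset.sum_add_distrib]
  ring

lemma S_Phi (b w c) : SS m (Phi m ℓ f b w c) = chi c * SS m (Phi m ℓ f b w 0) := by
  unfold SS Phi
  rw [Finset.mul_sum]
  simp only [chi_add, chi_zero]
  exact Finset.sum_congr rfl fun x _ => by ring

lemma S_Phi_bent (hf : IsBentVectorial m ℓ f) (b w) (hb : b ≠ 0) :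
    SS m (Phi m ℓ f b w 0) = 2^m ∨ SS m (Phi m ℓ f b w 0) = -2^m := by
  have h := hf b hb w
  have := (abs_eq (by positivity)).1 h
  simpa [SS, Phi, chi] using this

lemma S_Phi_zero (w : GaloisField 2 (2*m)) (hw : w ≠ 0) (c) : SS m (Phi m ℓ f 0 w c) = 0 := by
  rw [S_Phi]
  have := S_tr m w hw
  have e : Phi m ℓ f 0 w 0 = fun x => tr m (w * x) := by
    funext x
    simp [Phi]
  rw [e, this, mul_zero]

lemma S_zero (hm : 2 ≤ m) : SS m 0 = 2^(2*m) := by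
  simp [SS, chi_zero, cardF m hm]

lemma pow_lt' (hm : 2 ≤ m) : (2:ℤ)^m < 2^(2*m) :=
  pow_lt_pow_right₀ (by norm_num) (by omega)

lemma Phi_000 : Phi m ℓ f 0 0 0 = 0 := by
  funext x; simp [Phi, tr_zero]

lemma Phi_ker (hm : 2 ≤ m) (hf : IsBentVectorial m ℓ f) (b w c)
    (h : Phi m ℓ f b w c = 0) : b = 0 ∧ w = 0 ∧ c = 0 := by
  have h0 := S_zero m hm
  have hl := pow_lt' m hm
  have hp : (0:ℤ) < 2^m := by positivity
  rw [← h] at h0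
  have hb : b = 0 := by
    by_contra hb
    rw [S_Phi] at h0
    rcases chi_cases c with rfl | rfl <;> rcases S_Phi_bent m ℓ f hf b w hb with h | h <;>
      rw [h] at h0 <;> simp only [chi_zero, chi_one] at h0 <;> linarith
  subst hb
  have hw : w = 0 := by
    by_contra hw
    rw [S_Phi_zero m ℓ f w hw] at h0
    linarith
  subst hw
  refine ⟨rfl, rfl, ?_⟩
  have := congrFun h 0
  simpa [Phi, tr_zero] using this

lemma z2_add_self {α : Type*} (g : α → ZMod 2) : g + g = 0 := by
  funext x
  exact CharTwo.add_self_eq_zero _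

lemma z2_add_eq {α : Type*} (g h : α → ZMod 2) : g + h = 0 ↔ g = h := by
  constructor
  · intro e; funext x; exact CharTwo.add_eq_zero.1 (congrFun e x)
  · rintro rfl; exact z2_add_self _

lemma gf_add_eq (g h : GaloisField 2 (2*m)) : g + h = 0 ↔ g = h := CharTwo.add_eq_zero

lemma Phi_inj (hm : 2 ≤ m) (hf : IsBentVectorial m ℓ f) (b w c b' w' c')
    (h : Phi m ℓ f b w c = Phi m ℓ f b' w' c') : b = b' ∧ w = w' ∧ c = c' := by
  rw [← z2_add_eq, Phi_add] at h
  obtain ⟨h1, h2, h3⟩ := Phi_ker m ℓ f hm hf _ _ _ h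
  exact ⟨(z2_add_eq _ _).1 h1, (gf_add_eq m _ _).1 h2, CharTwo.add_eq_zero.1 h3⟩

lemma mem_code (g) : g ∈ code m ℓ f ↔ ∃ b w c, g = Phi m ℓ f b w c := by
  constructor
  · intro h
    refine Submodule.span_induction ?_ ?_ ?_ ?_ h
    · rintro x ((⟨j, rfl⟩ | ⟨w, rfl⟩) | rfl)
      · refine ⟨Pi.single j 1, 0, 0, ?_⟩
        funext x
        simp [Phi, tr_zero, Pi.single_apply]
      · refine ⟨0, w, 0, ?_⟩
        funext x
        simp [Phi]
      · refine ⟨0, 0, 1, ?_⟩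
        funext x
        simp [Phi, tr_zero]
    · exact ⟨0, 0, 0, (Phi_000 m ℓ f).symm⟩
    · rintro _ _ _ _ ⟨b, w, c, rfl⟩ ⟨b', w', c', rfl⟩
      exact ⟨_, _, _, Phi_add m ℓ f _ _ _ _ _ _⟩
    · rintro a _ _ ⟨b, w, c, rfl⟩
      rcases chi_cases a with rfl | rfl
      · exact ⟨0, 0, 0, by rw [Phi_000, zero_smul]⟩
      · exact ⟨b, w, c, one_smul _ _⟩
  · rintro ⟨b, w, c, rfl⟩
    have e : Phi m ℓ f b w c = ∑ j, b j • f j + (fun x => tr m (w * x)) + c • (fun _ => (1:ZMod 2)) := by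
      funext x
      simp [Phi]
    rw [e]
    refine Submodule.add_mem _ (Submodule.add_mem _ (Submodule.sum_mem _ fun j _ => ?_) ?_) ?_
    · exact Submodule.smul_mem _ _ (Submodule.subset_span (Or.inl (Or.inl ⟨j, rfl⟩)))
    · exact Submodule.subset_span (Or.inl (Or.inr ⟨w, rfl⟩))
    · exact Submodule.smul_mem _ _ (Submodule.subset_span (Or.inr rfl))

/-- The sign constant making the Walsh sum positive. -/
def cc (b : Fin ℓ → ZMod 2) (w : GaloisField 2 (2*m)) : ZMod 2 :=
  if SS m (Phi m ℓ f b w 0) = 2^m then 0 else 1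

/-- The minimum weight codeword with parameters `(b, w)`. -/
def Psi (p : (Fin ℓ → ZMod 2) × GaloisField 2 (2*m)) : GaloisField 2 (2*m) → ZMod 2 :=
  Phi m ℓ f p.1 p.2 (cc m ℓ f p.1 p.2)

lemma chi_cc (hf : IsBentVectorial m ℓ f) (b w) (hb : b ≠ 0) :
    2^m * chi (cc m ℓ f b w) = SS m (Phi m ℓ f b w 0) := by
  unfold cc
  split_ifs with h
  · rw [h, chi_zero, mul_one]
  · rcases S_Phi_bent m ℓ f hf b w hb with h' | h'
    · exact absurd h' h
    · rw [h', chi_one]; ring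

lemma S_Psi (hf : IsBentVectorial m ℓ f) (b w) (hb : b ≠ 0) : SS m (Psi m ℓ f (b, w)) = 2^m := by
  simp only [Psi]
  rw [S_Phi, ← chi_cc m ℓ f hf b w hb, mul_left_comm, chi_sq, mul_one]

lemma Psi_inj (hm : 2 ≤ m) (hf : IsBentVectorial m ℓ f) : Function.Injective (Psi m ℓ f) := by
  rintro ⟨b, w⟩ ⟨b', w'⟩ h
  obtain ⟨h1, h2, _⟩ := Phi_inj m ℓ f hm hf _ _ _ _ _ _ h
  exact Prod.ext h1 h2

lemma min_iff (hm : 2 ≤ m) (hf : IsBentVectorial m ℓ f) (v) :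
    (v ∈ code m ℓ f ∧ SS m v = 2^m) ↔ ∃ p : (Fin ℓ → ZMod 2) × GaloisField 2 (2*m),
      p.1 ≠ 0 ∧ v = Psi m ℓ f p := by
  have hl := pow_lt' m hm
  have hp : (0:ℤ) < 2^m := by positivity
  constructor
  · rintro ⟨h, hs⟩
    obtain ⟨b, w, c, rfl⟩ := (mem_code m ℓ f v).1 h
    have hb : b ≠ 0 := by
      rintro rfl
      by_cases hw : w = 0
      · subst hw
        rw [S_Phi, Phi_000, S_zero m hm] at hs
        rcases chi_cases c with rfl | rfl
        · rw [chi_zero] at hs; linarith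
        · rw [chi_one] at hs; linarith
      · rw [S_Phi_zero m ℓ f w hw] at hs
        linarith
    refine ⟨(b, w), hb, ?_⟩
    have h2 := S_Psi m ℓ f hf b w hb
    simp only [Psi] at h2 ⊢
    congr 1
    rw [S_Phi] at hs h2
    rcases chi_cases c with h | h <;> rcases chi_cases (cc m ℓ f b w) with h' | h' <;>
      rw [h] at hs ⊢ <;> rw [h'] at h2 ⊢ <;> rw [chi_zero, chi_one] at * <;> linarith
  · rintro ⟨⟨b, w⟩, hb, rfl⟩
    exact ⟨(mem_code m ℓ f _).2 ⟨_, _, _, rfl⟩, S_Psi m ℓ f hf b w hb⟩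

/-- Sum over `w` of the correlation with `u`. -/
lemma sum_corr (hm : 2 ≤ m) (hf : IsBentVectorial m ℓ f) (u) (hu : SS m u = 2^m) (b) (hb : b ≠ 0) :
    ∑ w, SS m (u + Psi m ℓ f (b, w)) = 2^(2*m) := by
  have hp : (2:ℤ)^m ≠ 0 := by positivity
  apply mul_left_cancel₀ hp
  set g : GaloisField 2 (2*m) → ZMod 2 := fun x => ∑ j, b j * f j x with hg
  have e1 : ∀ w, 2^m * SS m (u + Psi m ℓ f (b, w)) =
      ∑ x, ∑ y, chi (u x) * chi (g x) * chi (g y) * chi (tr m (w * (x + y))) := by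
    intro w
    have : SS m (u + Psi m ℓ f (b, w)) = chi (cc m ℓ f b w) *
        ∑ x, chi (u x) * chi (g x) * chi (tr m (w * x)) := by
      simp only [SS, Psi, Phi, Pi.add_apply, chi_add, Finset.mul_sum, hg]
      exact Finset.sum_congr rfl fun x _ => by ring
    rw [this, ← mul_assoc, chi_cc m ℓ f hf b w hb, mul_comm, SS, Finset.sum_mul_sum]
    refine Finset.sum_congr rfl fun x _ => Finset.sum_congr rfl fun y _ => ?_
    simp only [Phi, mul_add, tr_add, chi_add, chi_zero, hg]
    ring
  rw [Finset.mul_sum]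
  simp only [e1]
  rw [Finset.sum_comm]
  have e2 : ∀ x, ∑ w, ∑ y, chi (u x) * chi (g x) * chi (g y) * chi (tr m (w * (x + y))) =
      chi (u x) * 2^(2*m) := by
    intro x
    rw [Finset.sum_comm]
    simp only [← Finset.mul_sum]
    rw [Finset.sum_eq_single x]
    · rw [CharTwo.add_self_eq_zero]
      simp only [mul_zero, tr_zero, chi_zero, Finset.sum_const, Finset.card_univ, cardF m hm]
      rw [mul_assoc (chi (u x)), chi_sq]
      simp
    · intro y _ hy
      rw [sum_tr, mul_zero]
      intro h
      exact hy ((gf_add_eq m _ _).1 h).symm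
    · simp
  simp only [e2]
  rw [← Finset.sum_mul, ← hu, SS]

lemma corr_cases (hf : IsBentVectorial m ℓ f) (a : (Fin ℓ → ZMod 2) × GaloisField 2 (2*m)) (b w)
    (hab : b ≠ a.1) :
    SS m (Psi m ℓ f a + Psi m ℓ f (b, w)) = 2^m ∨ SS m (Psi m ℓ f a + Psi m ℓ f (b, w)) = -2^m := by
  simp only [Psi]
  rw [Phi_add, S_Phi]
  have h : a.1 + b ≠ 0 := fun h => hab ((z2_add_eq _ _).1 h).symm
  rcases S_Phi_bent m ℓ f hf (a.1 + b) (a.2 + w) h with h | h <;> rw [h] <;>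
    rcases chi_cases (cc m ℓ f a.1 a.2 + cc m ℓ f b w) with h | h <;> rw [h] <;>
    simp [chi_zero, chi_one]

lemma count_b (hm : 2 ≤ m) (hf : IsBentVectorial m ℓ f)
    (a : (Fin ℓ → ZMod 2) × GaloisField 2 (2*m)) (ha : a.1 ≠ 0) (b) (hb : b ≠ 0) (hab : b ≠ a.1) :
    2 * (Finset.univ.filter fun w => SS m (Psi m ℓ f a + Psi m ℓ f (b, w)) = 2^m).card
      = 2^m * (2^m + 1) ∧
    2 * (Finset.univ.filter fun w => SS m (Psi m ℓ f a + Psi m ℓ f (b, w)) = -2^m).card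
      = 2^m * (2^m - 1) := by
  have hp : (0:ℤ) < 2^m := by positivity
  have hs := sum_corr m ℓ f hm hf (Psi m ℓ f a) (S_Psi m ℓ f hf a.1 a.2 ha) b hb
  have hc := corr_cases m ℓ f hf a b
  set T : GaloisField 2 (2*m) → ℤ := fun w => SS m (Psi m ℓ f a + Psi m ℓ f (b, w)) with hT
  have k1 : ((Finset.univ.filter fun w => T w = 2^m).card : ℤ) +
      ((Finset.univ.filter fun w => T w = -2^m).card : ℤ) = 2^(2*m) := by
    rw [← Finset.sum_boole, ← Finset.sum_boole, ← Finset.sum_add_distrib]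
    have : ((2:ℤ)^(2*m)) = ∑ x : GaloisField 2 (2*m), 1 := by
      simp [cardF m hm]
    rw [this]
    refine Finset.sum_congr rfl fun w _ => ?_
    have h1 : (2:ℤ)^m ≠ -2^m := by intro h; linarith
    rcases hc w hab with h | h
    · change T w = _ at h
      rw [h, if_pos rfl, if_neg h1]; rfl
    · change T w = _ at h
      rw [h, if_pos rfl, if_neg h1.symm]; rfl
  have k2 : 2^m * (((Finset.univ.filter fun w => T w = 2^m).card : ℤ) -
      ((Finset.univ.filter fun w => T w = -2^m).card : ℤ)) = 2^m * 2^m := by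
    rw [← pow_add, ← two_mul, ← hs]
    rw [← Finset.sum_boole, ← Finset.sum_boole, ← Finset.sum_sub_distrib, Finset.mul_sum]
    refine Finset.sum_congr rfl fun w _ => ?_
    have h1 : (2:ℤ)^m ≠ -2^m := by intro h; linarith
    rcases hc w hab with h | h
    · change T w = _ at h
      rw [h, if_pos rfl, if_neg h1]; ring
    · change T w = _ at h
      rw [h, if_pos rfl, if_neg h1.symm]; ring
  have k3 := mul_left_cancel₀ hp.ne' k2
  have k4 : (2:ℤ)^(2*m) = 2^m * 2^m := by ring
  have h1 : 1 ≤ 2^m := Nat.one_le_two_pow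
  change 2 * (Finset.univ.filter fun w => T w = 2^m).card = _ ∧
    2 * (Finset.univ.filter fun w => T w = -2^m).card = _
  zify [h1]
  constructor <;> linarith

/-- The corresponding count over all `b ∉ {0, a}`. -/
lemma count_all (hℓ : 2 ≤ ℓ) (a : Fin ℓ → ZMod 2) (ha : a ≠ 0)
    (Q : (Fin ℓ → ZMod 2) → GaloisField 2 (2*m) → Prop) (c : ℕ)
    (h : ∀ b, b ≠ 0 → b ≠ a → 2 * {w | Q b w}.ncard = c) :
    {p : (Fin ℓ → ZMod 2) × GaloisField 2 (2*m) | p.1 ≠ 0 ∧ p.1 ≠ a ∧ Q p.1 p.2}.ncard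
      = c * (2^(ℓ-1) - 1) := by
  classical
  set B : Finset (Fin ℓ → ZMod 2) := (Finset.univ.erase 0).erase a with hB
  have hBc : B.card = 2 * (2^(ℓ-1) - 1) := by
    rw [hB, Finset.card_erase_of_mem (by simp [ha]), Finset.card_erase_of_mem (by simp)]
    obtain ⟨k, rfl⟩ := Nat.exists_eq_add_of_le' hℓ
    simp [ZMod.card]
    have : 2^(k+2) = 2 * 2^(k+1) := by ring
    omega
  have e : {p : (Fin ℓ → ZMod 2) × GaloisField 2 (2*m) | p.1 ≠ 0 ∧ p.1 ≠ a ∧ Q p.1 p.2} =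
      ↑((B.sigma fun b => Finset.univ.filter fun w => Q b w).map
        (Equiv.sigmaEquivProd _ _).toEmbedding) := by
    ext ⟨b, w⟩
    simp [hB]
    tauto
  rw [e, Set.ncard_coe_finset, Finset.card_map, Finset.card_sigma]
  have h2 : 2 * ∑ b ∈ B, (Finset.univ.filter fun w => Q b w).card = B.card * c := by
    rw [Finset.mul_sum, Finset.sum_const_nat]
    intro b hb
    simp only [hB, Finset.mem_erase] at hb
    rw [← h b hb.2.1 hb.1, Set.ncard_eq_toFinset_card']
    simp
  rw [hBc] at h2
  linarith

/-- Pull back a count of codewords to parameters. -/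
lemma count_pull (hm : 2 ≤ m) (hf : IsBentVectorial m ℓ f) (R : (GaloisField 2 (2*m) → ZMod 2) → Prop) :
    {v | (v ∈ code m ℓ f ∧ SS m v = 2^m) ∧ R v}.ncard =
    {p : (Fin ℓ → ZMod 2) × GaloisField 2 (2*m) | p.1 ≠ 0 ∧ R (Psi m ℓ f p)}.ncard := by
  rw [← Set.ncard_image_of_injective _ (Psi_inj m ℓ f hm hf)]
  congr 1
  ext v
  simp only [Set.mem_ofPred_eq, min_iff m ℓ f hm hf, Set.mem_image]
  constructor
  · rintro ⟨⟨p, hp, rfl⟩, h⟩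
    exact ⟨p, ⟨hp, h⟩, rfl⟩
  · rintro ⟨p, ⟨hp, h⟩, rfl⟩
    exact ⟨⟨p, hp, rfl⟩, h⟩

/-- Correlation within the same class `b = a`. -/
lemma corr_same (a : (Fin ℓ → ZMod 2) × GaloisField 2 (2*m)) (w)
    (hw : w ≠ a.2) : SS m (Psi m ℓ f a + Psi m ℓ f (a.1, w)) = 0 := by
  simp only [Psi]
  rw [Phi_add, z2_add_self]
  exact S_Phi_zero m ℓ f _ (fun h => hw ((gf_add_eq m _ _).1 h).symm) _

lemma corr_self (hm : 2 ≤ m) (a : (Fin ℓ → ZMod 2) × GaloisField 2 (2*m)) :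
    SS m (Psi m ℓ f a + Psi m ℓ f a) = 2^(2*m) := by
  rw [z2_add_self, S_zero m hm]

end

/-- the multiplicities of the three block intersection numbers
of the design supported by the minimum weight codewords of `C(f_1, …, f_ℓ)`,
`2 ≤ ℓ ≤ m`. -/
theorem stmt_8 (m ℓ : ℕ) (hm : 2 ≤ m) (hℓ1 : 2 ≤ ℓ) (hℓm : ℓ ≤ m)
    (f : Fin ℓ → GaloisField 2 (2*m) → ZMod 2) (hf : IsBentVectorial m ℓ f)
    (u : GaloisField 2 (2*m) → ZMod 2)
    (hu : u ∈ code m ℓ f) (hwu : wt m u = 2^(2*m-1) - 2^(m-1)) :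
    ({v | v ∈ code m ℓ f ∧ wt m v = 2^(2*m-1) - 2^(m-1) ∧ v ≠ u ∧
        (supp m u ∩ supp m v).ncard = 2^(2*m-2) - 2^(m-2)}.ncard =
      2^m * (2^m + 1) * (2^(ℓ-1) - 1)) ∧
    ({v | v ∈ code m ℓ f ∧ wt m v = 2^(2*m-1) - 2^(m-1) ∧ v ≠ u ∧
        (supp m u ∩ supp m v).ncard = 2^(2*m-2) - 2^(m-1)}.ncard =
      2^(2*m) - 1) ∧
    ({v | v ∈ code m ℓ f ∧ wt m v = 2^(2*m-1) - 2^(m-1) ∧ v ≠ u ∧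
        (supp m u ∩ supp m v).ncard = 2^(2*m-2) - 3 * 2^(m-2)}.ncard =
      2^m * (2^m - 1) * (2^(ℓ-1) - 1)) := by
  have hl := pow_lt' m hm
  have hp : (0:ℤ) < 2^m := by positivity
  have hsu := (wt_iff m hm u).1 hwu
  obtain ⟨a, ha, rfl⟩ := (min_iff m ℓ f hm hf u).1 ⟨hu, hsu⟩
  have key : ∀ (t : ℕ) (s : ℤ),
      (∀ v, SS m v = 2^m → ((supp m (Psi m ℓ f a) ∩ supp m v).ncard = t ↔
        SS m (Psi m ℓ f a + v) = s)) →
      {v | v ∈ code m ℓ f ∧ wt m v = 2^(2*m-1) - 2^(m-1) ∧ v ≠ Psi m ℓ f a ∧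
        (supp m (Psi m ℓ f a) ∩ supp m v).ncard = t}.ncard =
      {p : (Fin ℓ → ZMod 2) × GaloisField 2 (2*m) | p.1 ≠ 0 ∧ p ≠ a ∧
        SS m (Psi m ℓ f a + Psi m ℓ f p) = s}.ncard := by
    intro t s h
    have h1 := count_pull m ℓ f hm hf (fun v => v ≠ Psi m ℓ f a ∧ SS m (Psi m ℓ f a + v) = s)
    simp only [ne_eq, (Psi_inj m ℓ f hm hf).eq_iff] at h1
    simp only [ne_eq]
    rw [← h1]
    congr 1
    ext v
    simp only [Set.mem_ofPred_eq, wt_iff m hm v]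
    constructor
    · rintro ⟨h1, h2, h3, h4⟩
      exact ⟨⟨h1, h2⟩, h3, (h v h2).1 h4⟩
    · rintro ⟨⟨h1, h2⟩, h3, h4⟩
      exact ⟨h1, h2, h3, (h v h2).2 h4⟩
  -- the sets with nonzero correlation only see `b ≠ a.1`
  have key2 : ∀ (s : ℤ), s ≠ 0 →
      {p : (Fin ℓ → ZMod 2) × GaloisField 2 (2*m) | p.1 ≠ 0 ∧ p ≠ a ∧
        SS m (Psi m ℓ f a + Psi m ℓ f p) = s} =
      {p : (Fin ℓ → ZMod 2) × GaloisField 2 (2*m) | p.1 ≠ 0 ∧ p.1 ≠ a.1 ∧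
        SS m (Psi m ℓ f a + Psi m ℓ f (p.1, p.2)) = s} := by
    intro s hs
    ext ⟨b, w⟩
    simp only [Set.mem_ofPred_eq]
    constructor
    · rintro ⟨h1, h2, h3⟩
      refine ⟨h1, ?_, h3⟩
      rintro rfl
      apply hs
      rw [← h3]
      exact corr_same m ℓ f a w (fun h => h2 (Prod.ext rfl h))
    · rintro ⟨h1, h2, h3⟩
      exact ⟨h1, fun h => h2 (congrArg Prod.fst h), h3⟩
  refine ⟨?_, ?_, ?_⟩
  · rw [key _ (2^m) (fun v hv => (inter_iff m hm _ v hsu hv).1), key2 _ hp.ne']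
    refine count_all m ℓ hℓ1 a.1 ha
      (fun b w => SS m (Psi m ℓ f a + Psi m ℓ f (b, w)) = 2^m) _ fun b hb hab => ?_
    rw [← (count_b m ℓ f hm hf a ha b hb hab).1, Set.ncard_eq_toFinset_card']
    simp
  · rw [key _ 0 (fun v hv => (inter_iff m hm _ v hsu hv).2.1)]
    have e : {p : (Fin ℓ → ZMod 2) × GaloisField 2 (2*m) | p.1 ≠ 0 ∧ p ≠ a ∧
        SS m (Psi m ℓ f a + Psi m ℓ f p) = 0} = (fun w => (a.1, w)) '' {w | w ≠ a.2} := by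
      ext ⟨b, w⟩
      simp only [Set.mem_ofPred_eq, Set.mem_image]
      constructor
      · rintro ⟨h1, h2, h3⟩
        have hb : b = a.1 := by
          by_contra hb
          rcases corr_cases m ℓ f hf a b w hb with h | h <;> rw [h3] at h <;> linarith
        subst hb
        exact ⟨w, fun h => h2 (Prod.ext rfl h), rfl⟩
      · rintro ⟨w', h, h'⟩
        obtain ⟨rfl, rfl⟩ := Prod.mk.inj h'
        exact ⟨ha, fun h2 => h (congrArg Prod.snd h2), corr_same m ℓ f a _ h⟩
    rw [e, Set.ncard_image_of_injective _ (fun x y h => (Prod.mk.inj h).2)]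
    have : {w | w ≠ a.2} = ({a.2} : Set (GaloisField 2 (2*m)))ᶜ := rfl
    rw [this, Set.ncard_compl, Set.ncard_singleton, Nat.card_eq_fintype_card, cardF m hm]
  · rw [key _ (-2^m) (fun v hv => (inter_iff m hm _ v hsu hv).2.2), key2 _ (by linarith [hp])]
    refine count_all m ℓ hℓ1 a.1 ha
      (fun b w => SS m (Psi m ℓ f a + Psi m ℓ f (b, w)) = -2^m) _ fun b hb hab => ?_
    rw [← (count_b m ℓ f hm hf a ha b hb hab).2, Set.ncard_eq_toFinset_card']
    simp
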